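/- Let ν > 1/2, x ∈ ℝ and m, n ∈ ℕ. Then the ultraspherical polynomials satisfy the convolution identity ((m+n)! / ((2ν)_{m+n} · m! · n!)) · C_{m+n}^ν(x) = Σ_{k=0}^{min(m,n)} [(k + ν - 1/2)(-1)^k (2ν-1)_k / (k! (ν+1/2)_k (ν-1/2)_{k+1})] · ((1-x²)^k/4^k) · C_{m-k}^{ν+k}(x) · C_{n-k}^{ν+k}(x) / ((2ν+2k)_{m-k} (2ν+2k)_{n-k}). -/

import Mathlib

/-- The Pochhammer symbol `(a)_n = a(a+1)⋯(a+n-1)`. -/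
noncomputable def poch (a : ℝ) (n : ℕ) : ℝ := ∏ i ∈ Finset.range n, (a + i)

/-- The ultraspherical (Gegenbauer) polynomial `C_n^ν(x)`. -/
noncomputable def gegenbauerC (ν : ℝ) (n : ℕ) (x : ℝ) : ℝ :=
  ∑ k ∈ Finset.range (n / 2 + 1),
    (-1) ^ k * poch ν (n - k) * (2 * x) ^ (n - 2 * k) /
      (k.factorial * (n - 2 * k).factorial)

lemma poch_zero (a : ℝ) : poch a 0 = 1 := by simp [poch]

lemma poch_succ (a : ℝ) (n : ℕ) : poch a (n + 1) = poch a n * (a + n) := by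
  simp [poch, Finset.prod_range_succ]

lemma poch_succ_left (a : ℝ) (n : ℕ) : poch a (n + 1) = a * poch (a + 1) n := by
  simp only [poch, Finset.prod_range_succ']
  rw [mul_comm]
  congr 1
  · simp
  · apply Finset.prod_congr rfl
    intro i _
    push_cast
    ring

lemma poch_pos {a : ℝ} (ha : 0 < a) (n : ℕ) : 0 < poch a n := by
  unfold poch
  apply Finset.prod_pos
  intro i _
  positivity

/-- Terms of the Gegenbauer sum, extended by zero. -/
noncomputable def gT (ν x : ℝ) (n k : ℕ) : ℝ :=
  if 2 * k ≤ n then (-1) ^ k * poch ν (n - k) * (2 * x) ^ (n - 2 * k) /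
      (k.factorial * (n - 2 * k).factorial) else 0

lemma gT_eq (ν x : ℝ) (k j : ℕ) : gT ν x (2 * k + j) k =
    (-1) ^ k * poch ν (k + j) * (2 * x) ^ j / (k.factorial * j.factorial) := by
  have h1 : 2 * k + j - k = k + j := by omega
  have h2 : 2 * k + j - 2 * k = j := by omega
  rw [gT, if_pos (by omega), h1, h2]

lemma gT_zero (ν x : ℝ) {n k : ℕ} (h : n < 2 * k) : gT ν x n k = 0 := by
  rw [gT, if_neg (by omega)]

lemma geg_eq (ν x : ℝ) (n N : ℕ) (h : n / 2 + 1 ≤ N) :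
    gegenbauerC ν n x = ∑ k ∈ Finset.range N, gT ν x n k := by
  rw [← Finset.sum_subset (Finset.range_mono h)]
  · unfold gegenbauerC
    apply Finset.sum_congr rfl
    intro k hk
    rw [Finset.mem_range] at hk
    rw [gT, if_pos (by omega)]
  · intro k _ hk
    rw [Finset.mem_range] at hk
    exact gT_zero _ _ (by omega)

lemma geg_zero (ν x : ℝ) : gegenbauerC ν 0 x = 1 := by
  simp [gegenbauerC, poch]

lemma geg_one (ν x : ℝ) : gegenbauerC ν 1 x = 2 * ν * x := by
  simp [gegenbauerC, poch]
  ring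

lemma gT_E (l x : ℝ) (n k : ℕ) : (n + 1 + 2 * l) * gT l x (n + 1) k =
    2 * l * (gT (l + 1) x (n + 1) k - x * gT (l + 1) x n k) := by
  rcases lt_trichotomy (n + 1) (2 * k) with h | h | h
  · rw [gT_zero _ _ h, gT_zero _ _ h, gT_zero _ _ (by omega)]; simp
  · rw [gT_zero (l + 1) x (show n < 2 * k by omega), h]
    have e1 := gT_eq l x k 0
    have e2 := gT_eq (l + 1) x k 0
    simp only [add_zero] at e1 e2
    rw [e1, e2]
    have hn : (n : ℝ) + 1 = 2 * k := by exact_mod_cast h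
    have hp : poch l k * (l + k) = l * poch (l + 1) k := by
      rw [← poch_succ, poch_succ_left]
    rw [hn]
    linear_combination (2 * (-1) ^ k * (2 * x) ^ 0 / (k.factorial * (Nat.factorial 0 : ℝ))) * hp
  · obtain ⟨j, rfl⟩ : ∃ j, n = 2 * k + j := ⟨n - 2 * k, by omega⟩
    rw [gT_eq, show 2 * k + j + 1 = 2 * k + (j + 1) by ring, gT_eq, gT_eq]
    rw [← add_assoc k j 1, poch_succ_left l, poch_succ (l + 1), Nat.factorial_succ]
    have h1 := Nat.factorial_ne_zero k
    have h2 := Nat.factorial_ne_zero j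
    push_cast
    field_simp
    ring

lemma geg_E (l x : ℝ) (n : ℕ) : (n + 1 + 2 * l) * gegenbauerC l (n + 1) x =
    2 * l * (gegenbauerC (l + 1) (n + 1) x - x * gegenbauerC (l + 1) n x) := by
  rw [geg_eq l x (n + 1) (n + 2) (by omega), geg_eq (l + 1) x (n + 1) (n + 2) (by omega),
    geg_eq (l + 1) x n (n + 2) (by omega), Finset.mul_sum, Finset.mul_sum,
    ← Finset.sum_sub_distrib, Finset.mul_sum]
  exact Finset.sum_congr rfl fun k _ => gT_E l x n k

lemma gT_D0 (l x : ℝ) (n : ℕ) : (n + 2) * gT l x (n + 2) 0 =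
    2 * l * (x * gT (l + 1) x (n + 1) 0) := by
  have e1 := gT_eq l x 0 (n + 2)
  have e2 := gT_eq (l + 1) x 0 (n + 1)
  simp only [mul_zero, zero_add] at e1 e2
  rw [e1, e2, poch_succ_left l, Nat.factorial_succ (n + 1)]
  have h2 := Nat.factorial_ne_zero (n + 1)
  have h3 : (n : ℝ) + 1 + 1 ≠ 0 := by positivity
  push_cast
  field_simp
  ring

lemma gT_D (l x : ℝ) (n k : ℕ) : (n + 2) * gT l x (n + 2) (k + 1) =
    2 * l * (x * gT (l + 1) x (n + 1) (k + 1) - gT (l + 1) x n k) := by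
  rcases lt_trichotomy n (2 * k) with h | h | h
  · rw [gT_zero _ _ (by omega), gT_zero _ _ (by omega), gT_zero _ _ h]; simp
  · rw [gT_zero (l + 1) x (show n + 1 < 2 * (k + 1) by omega), h]
    have e1 := gT_eq l x (k + 1) 0
    have e2 := gT_eq (l + 1) x k 0
    simp only [add_zero] at e1 e2
    rw [show 2 * k + 2 = 2 * (k + 1) by ring, e1, e2, poch_succ_left, Nat.factorial_succ]
    have h2 := Nat.factorial_ne_zero k
    push_cast
    field_simp
    ring
  · obtain ⟨j, rfl⟩ : ∃ j, n = 2 * k + (j + 1) := ⟨n - 2 * k - 1, by omega⟩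
    rw [gT_eq, show 2 * k + (j + 1) + 1 = 2 * (k + 1) + j by ring,
      show 2 * k + (j + 1) + 2 = 2 * (k + 1) + (j + 1) by ring, gT_eq, gT_eq]
    rw [show k + 1 + (j + 1) = (k + j + 1) + 1 by ring, show k + 1 + j = k + j + 1 by ring,
      show k + (j + 1) = k + j + 1 by ring,
      poch_succ_left l, Nat.factorial_succ, Nat.factorial_succ]
    have h1 := Nat.factorial_ne_zero k
    have h2 := Nat.factorial_ne_zero j
    push_cast
    field_simp
    ring

lemma geg_D (l x : ℝ) (n : ℕ) : (n + 2) * gegenbauerC l (n + 2) x =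
    2 * l * (x * gegenbauerC (l + 1) (n + 1) x - gegenbauerC (l + 1) n x) := by
  rw [geg_eq l x (n + 2) (n + 3) (by omega), geg_eq (l + 1) x (n + 1) (n + 3) (by omega),
    geg_eq (l + 1) x n (n + 2) (by omega), Finset.sum_range_succ',
    Finset.sum_range_succ' _ (n + 2), mul_add, mul_add, gT_D0, Finset.mul_sum, Finset.mul_sum]
  rw [add_sub_right_comm, ← Finset.sum_sub_distrib, mul_add, Finset.mul_sum]
  congr 1
  exact Finset.sum_congr rfl fun k _ => gT_D l x n k

/-- Normalised Gegenbauer polynomial. -/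
noncomputable def gr (l x : ℝ) (n : ℕ) : ℝ := gegenbauerC l n x / poch (2 * l) n

lemma gr_mul {l : ℝ} (hl : 0 < l) (x : ℝ) (n : ℕ) :
    gegenbauerC l n x = gr l x n * poch (2 * l) n := by
  have := (poch_pos (show 0 < 2 * l by linarith) n).ne'
  rw [gr]; field_simp

lemma gr_zero (l x : ℝ) : gr l x 0 = 1 := by simp [gr, geg_zero, poch_zero]

lemma gr_one {l : ℝ} (hl : 0 < l) (x : ℝ) : gr l x 1 = x := by
  simp [gr, geg_one, poch]
  field_simp

lemma poch_two {l : ℝ} (n : ℕ) :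
    poch (2 * l) (n + 2) = 2 * l * ((2 * l + 1) * poch (2 * (l + 1)) n) := by
  rw [poch_succ_left, poch_succ_left]
  ring_nf

lemma gr_E {l : ℝ} (hl : 0 < l) (x : ℝ) (n : ℕ) : (2 * l + 1) * gr l x (n + 1) =
    (2 * l + 2 + n) * gr (l + 1) x (n + 1) - x * gr (l + 1) x n := by
  have h := geg_E l x n
  rw [gr_mul hl, gr_mul (by linarith : 0 < l + 1), gr_mul (by linarith : 0 < l + 1),
    poch_succ (2 * (l + 1))] at h
  have h2 := poch_two (l := l) n
  rw [poch_succ] at h2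
  push_cast at h2
  have hp := poch_pos (show 0 < 2 * (l + 1) by linarith) n
  have : (2 * l * poch (2 * (l + 1)) n) ≠ 0 := by positivity
  apply mul_left_cancel₀ this
  linear_combination h - gr l x (n + 1) * h2

lemma gr_D {l : ℝ} (hl : 0 < l) (x : ℝ) (n : ℕ) : (n + 2) * (2 * l + 1) * gr l x (n + 2) =
    (2 * l + 2 + n) * x * gr (l + 1) x (n + 1) - gr (l + 1) x n := by
  have h := geg_D l x n
  rw [gr_mul hl, gr_mul (by linarith : 0 < l + 1), gr_mul (by linarith : 0 < l + 1),
    poch_succ (2 * (l + 1)), poch_two] at h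
  have hp := poch_pos (show 0 < 2 * (l + 1) by linarith) n
  have : (2 * l * poch (2 * (l + 1)) n) ≠ 0 := by positivity
  apply mul_left_cancel₀ this
  linear_combination h

lemma gr_I {l : ℝ} (hl : 0 < l) (x : ℝ) (n : ℕ) :
    (2 * l + 1) * ((n + 2) * gr l x (n + 2) - x * gr l x (n + 1)) =
      -(1 - x ^ 2) * gr (l + 1) x n := by
  linear_combination gr_D hl x n - x * gr_E hl x n

lemma gr_II {l : ℝ} (hl : 0 < l) (x : ℝ) (n : ℕ) :
    (2 * l + 1) * (2 * l + 3) * (gr (l + 1) x (n + 2) - gr l x (n + 2)) =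
      (1 - x ^ 2) * gr (l + 2) x n := by
  have h1 := gr_I (show 0 < l + 1 by linarith) x n
  have h2 := gr_E hl x (n + 1)
  rw [show l + 1 + 1 = l + 2 by ring] at h1
  push_cast at h2
  linear_combination -h1 - (2 * l + 3) * h2

/-- The expansion coefficients. -/
noncomputable def gf (ν x : ℝ) (m k : ℕ) : ℝ :=
  if k ≤ m then (m.factorial : ℝ) * gr (ν + k) x (m - k) else 0

lemma gf_eq (ν x : ℝ) (k p : ℕ) :
    gf ν x (k + p) k = ((k + p).factorial : ℝ) * gr (ν + k) x p := by
  rw [gf, if_pos (by omega), Nat.add_sub_cancel_left]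

lemma gf_zero (ν x : ℝ) {m k : ℕ} (h : m < k) : gf ν x m k = 0 := by
  rw [gf, if_neg (by omega)]

noncomputable def ga (ν : ℝ) (k : ℕ) : ℝ :=
  (2 * ν - 1 + k) / ((2 * ν + 2 * k - 1) * (2 * ν + 2 * k + 1))

lemma gf_rec0 {ν : ℝ} (hν : 1 / 2 < ν) (x : ℝ) (m : ℕ) :
    gf ν x (m + 1) 0 = x * gf ν x m 0 - (1 - x ^ 2) * ga ν 0 * gf ν x m 1 := by
  have h0 : ∀ p, gf ν x p 0 = (p.factorial : ℝ) * gr ν x p := by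
    intro p
    have := gf_eq ν x 0 p
    simpa using this
  have ha : ga ν 0 * (2 * ν + 1) = 1 := by
    have : 2 * ν - 1 ≠ 0 := by linarith
    have : 2 * ν + 1 ≠ 0 := by linarith
    simp [ga]
    field_simp
  have hp : 2 * ν + 1 ≠ 0 := by linarith
  rw [h0, h0]
  rcases m with _ | n
  · rw [gf_zero _ _ (by omega), gr_zero, zero_add, gr_one (by linarith)]
    simp
  · have h1 := gf_eq ν x 1 n
    rw [add_comm 1 n] at h1
    rw [h1, Nat.factorial_succ (n + 1)]
    have hI := gr_I (by linarith : 0 < ν) x n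
    push_cast
    apply mul_left_cancel₀ hp
    linear_combination ((n + 1).factorial : ℝ) * hI
      + (1 - x ^ 2) * (n + 1).factorial * gr (ν + 1) x n * ha

lemma gf_rec {ν : ℝ} (hν : 1 / 2 < ν) (x : ℝ) (m k : ℕ) :
    gf ν x (m + 1) (k + 1) = x * gf ν x m (k + 1)
      - (1 - x ^ 2) * ga ν (k + 1) * gf ν x m (k + 2) + (k + 1) * gf ν x m k := by
  rcases lt_trichotomy m k with h | h | h
  · rw [gf_zero _ _ (by omega), gf_zero _ _ (by omega), gf_zero _ _ (by omega),
      gf_zero _ _ (by omega)]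
    simp
  · subst h
    rw [gf_zero _ _ (show m < m + 1 by omega), gf_zero _ _ (show m < m + 2 by omega)]
    have e1 := gf_eq ν x (m + 1) 0
    have e2 := gf_eq ν x m 0
    simp only [add_zero] at e1 e2
    rw [e1, e2, gr_zero, gr_zero, Nat.factorial_succ]
    push_cast
    ring
  · obtain ⟨p, rfl⟩ : ∃ p, m = k + 1 + p := ⟨m - k - 1, by omega⟩
    have hl : 0 < ν + k := by positivity
    have hl' : 0 < ν + k + 1 := by positivity
    have e1 := gf_eq ν x (k + 1) (p + 1)
    have e2 := gf_eq ν x (k + 1) p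
    have e3 := gf_eq ν x k (p + 1)
    rw [show k + (p + 1) = k + 1 + p by ring] at e3
    rw [show k + 1 + p + 1 = k + 1 + (p + 1) by ring, e1, e2, e3,
      show k + 1 + (p + 1) = k + 1 + p + 1 by ring, Nat.factorial_succ (k + 1 + p)]
    push_cast
    rw [← add_assoc ν]
    rcases p with _ | q
    · rw [gf_zero _ _ (by omega), zero_add, gr_zero, gr_one hl, gr_one hl']
      push_cast
      ring
    · have e4 := gf_eq ν x (k + 2) q
      rw [show k + 2 + q = k + 1 + (q + 1) by ring] at e4
      rw [e4]
      have h1 := gr_I hl' x q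
      have h2 := gr_II hl x q
      rw [show ν + k + 1 + 1 = ν + k + 2 by ring] at h1
      have hA : 2 * (ν + k) + 1 ≠ 0 := by positivity
      have hB : 2 * (ν + k) + 3 ≠ 0 := by positivity
      have ha : ga ν (k + 1) * ((2 * (ν + k) + 1) * (2 * (ν + k) + 3)) = 2 * ν + k := by
        rw [ga]
        push_cast
        rw [show 2 * ν + 2 * ((k : ℝ) + 1) - 1 = 2 * (ν + k) + 1 by ring,
          show 2 * ν + 2 * ((k : ℝ) + 1) + 1 = 2 * (ν + k) + 3 by ring,
          div_mul_cancel₀ _ (mul_ne_zero hA hB)]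
        ring
      push_cast
      rw [← add_assoc ν]
      apply mul_left_cancel₀ (mul_ne_zero hA hB)
      rw [show ν + ↑k + 2 = ν + k + 2 by ring] at *
      generalize ((k + 1 + (q + 1)).factorial : ℝ) = F
      generalize hg : gr (ν + k + 2) x q = g at *
      have h3 : gr (ν + (k + 2)) x q = g := by rw [← hg]; ring_nf
      try rw [h3]
      linear_combination F * (2 * (ν + k) + 1) * h1 + F * (k + 1) * h2
        + (1 - x ^ 2) * F * g * ha

/-- Weights. -/
noncomputable def gc (ν : ℝ) (k : ℕ) : ℝ :=
  ((k : ℝ) + ν - 1 / 2) * (-1) ^ k * poch (2 * ν - 1) k /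
            (k.factorial * poch (ν + 1 / 2) k * poch (ν - 1 / 2) (k + 1))

noncomputable def gw (ν x : ℝ) (k : ℕ) : ℝ := gc ν k * ((1 - x ^ 2) ^ k / 4 ^ k)

lemma gc_zero {ν : ℝ} (hν : 1 / 2 < ν) : gc ν 0 = 1 := by
  have : ν - 1 / 2 ≠ 0 := by linarith
  simp [gc, poch] at *
  exact this

lemma gc_succ {ν : ℝ} (hν : 1 / 2 < ν) (k : ℕ) : (k + 1) * gc ν (k + 1) = - 4 * ga ν k * gc ν k := by
  have hk : (0 : ℝ) ≤ k := by positivity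
  have h1 := (poch_pos (show 0 < ν + 1 / 2 by linarith) k).ne'
  have h2 := (poch_pos (show 0 < ν - 1 / 2 by linarith) k).ne'
  have h3 := Nat.factorial_ne_zero k
  unfold gc ga
  rw [poch_succ (2 * ν - 1) k, poch_succ (ν + 1 / 2) k, poch_succ _ (k + 1),
    poch_succ (ν - 1 / 2) k, Nat.factorial_succ]
  have e1 : 2 * ν + 2 * k - 1 = 2 * (ν - 1 / 2 + k) := by ring
  have e2 : 2 * ν + 2 * k + 1 = 2 * (ν + 1 / 2 + k) := by ring
  have e3 : k + ν - 1 / 2 = ν - 1 / 2 + k := by ring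
  push_cast
  have e4 : ν - 1 / 2 + (k + 1) = ν + 1 / 2 + k := by ring
  have e5 : k + 1 + ν - 1 / 2 = ν + 1 / 2 + k := by ring
  rw [e1, e2, e3, e4, e5, pow_succ]
  have p1 : ν - 1 / 2 + k ≠ 0 := by linarith
  have p2 : ν + 1 / 2 + k ≠ 0 := by linarith
  generalize ν - 1 / 2 + k = A at *
  generalize ν + 1 / 2 + k = B at *
  generalize poch (ν + 1 / 2) k = P at *
  generalize poch (ν - 1 / 2) k = Q at *
  field_simp
  ring

lemma gw_succ {ν : ℝ} (hν : 1 / 2 < ν) (x : ℝ) (k : ℕ) :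
    (k + 1) * gw ν x (k + 1) = - (1 - x ^ 2) * ga ν k * gw ν x k := by
  unfold gw
  rw [pow_succ, pow_succ]
  linear_combination ((1 - x ^ 2) ^ k * (1 - x ^ 2) / (4 ^ k * 4)) * gc_succ hν k

lemma gS_partial {ν : ℝ} (hν : 1 / 2 < ν) (x : ℝ) (m n N : ℕ) :
    ∑ k ∈ Finset.range (N + 1), gw ν x k *
      (gf ν x (m + 1) k * gf ν x n k - gf ν x m k * gf ν x (n + 1) k) =
    (N + 1) * gw ν x (N + 1) *
      (gf ν x m (N + 1) * gf ν x n N - gf ν x m N * gf ν x n (N + 1)) := by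
  induction N with
  | zero =>
    have h := gw_succ hν x 0
    rw [Finset.sum_range_one, gf_rec0 hν, gf_rec0 hν]
    push_cast at *
    simp only [zero_add] at *
    linear_combination (-(gf ν x m 1 * gf ν x n 0 - gf ν x m 0 * gf ν x n 1)) * h
  | succ N ih =>
    have h := gw_succ hν x (N + 1)
    rw [Finset.sum_range_succ, ih, gf_rec hν, gf_rec hν]
    push_cast at *
    simp only [add_assoc, one_add_one_eq_two] at *
    linear_combination (-(gf ν x m (N + 2) * gf ν x n (N + 1)
      - gf ν x m (N + 1) * gf ν x n (N + 2))) * h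

noncomputable def gS (ν x : ℝ) (m n N : ℕ) : ℝ :=
  ∑ k ∈ Finset.range N, gw ν x k * (gf ν x m k * gf ν x n k)

lemma gS_shift {ν : ℝ} (hν : 1 / 2 < ν) (x : ℝ) (m n N : ℕ) (hm : m ≤ N) (hn : n ≤ N) :
    gS ν x (m + 1) n (N + 1) = gS ν x m (n + 1) (N + 1) := by
  rw [← sub_eq_zero, gS, gS, ← Finset.sum_sub_distrib]
  simp only [← mul_sub]
  rw [gS_partial hν, gf_zero ν x (show m < N + 1 by omega), gf_zero ν x (show n < N + 1 by omega)]
  ring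

lemma gS_eq {ν : ℝ} (hν : 1 / 2 < ν) (x : ℝ) (n N : ℕ) : ∀ m, m + n ≤ N →
    gS ν x m n (N + 1) = gf ν x (m + n) 0 := by
  induction n with
  | zero =>
    intro m _
    rw [gS, Finset.sum_range_succ', Finset.sum_eq_zero]
    · have := gf_eq ν x 0 0
      simp only [add_zero] at this
      rw [this, gr_zero, gw, gc_zero hν]
      simp
    · intro k _
      rw [gf_zero ν x (show 0 < k + 1 by omega)]
      ring
  | succ n ih =>
    intro m h
    rw [← gS_shift hν x m n N (by omega) (by omega), ih _ (by omega)]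
    congr 1
    ring

/-- Convolution identity for the ultraspherical polynomials. -/
theorem ultraspherical_convolution (ν : ℝ) (hν : 1 / 2 < ν) (x : ℝ) (m n : ℕ) :
    ((m + n).factorial : ℝ) / (poch (2 * ν) (m + n) * m.factorial * n.factorial) *
        gegenbauerC ν (m + n) x =
      ∑ k ∈ Finset.range (min m n + 1),
        ((k : ℝ) + ν - 1 / 2) * (-1) ^ k * poch (2 * ν - 1) k /
            (k.factorial * poch (ν + 1 / 2) k * poch (ν - 1 / 2) (k + 1)) *
          ((1 - x ^ 2) ^ k / 4 ^ k) *
          (gegenbauerC (ν + k) (m - k) x * gegenbauerC (ν + k) (n - k) x /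
            (poch (2 * ν + 2 * k) (m - k) * poch (2 * ν + 2 * k) (n - k))) := by
  have h := gS_eq hν x n (m + n) m le_rfl
  have h1 : (m.factorial : ℝ) ≠ 0 := by exact_mod_cast Nat.factorial_ne_zero m
  have h2 : (n.factorial : ℝ) ≠ 0 := by exact_mod_cast Nat.factorial_ne_zero n
  have h0 := gf_eq ν x 0 (m + n)
  simp only [zero_add, Nat.cast_zero, add_zero] at h0
  have hp := (poch_pos (show 0 < 2 * ν by linarith) (m + n)).ne'
  rw [h0, gS, ← Finset.sum_subset
    (Finset.range_mono (show min m n + 1 ≤ m + n + 1 by omega))] at h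
  · apply mul_left_cancel₀ (mul_ne_zero h1 h2)
    trans ((m + n).factorial : ℝ) * gr ν x (m + n)
    · rw [gr]; field_simp
    · rw [← h, Finset.mul_sum]
      apply Finset.sum_congr rfl
      intro k hk
      rw [Finset.mem_range] at hk
      rw [gf, gf, if_pos (by omega), if_pos (by omega), gw, gc, gr, gr, mul_add 2 ν,
        mul_div_mul_comm]
      ring
  · intro k _ hk
    rw [Finset.mem_range] at hk
    rcases le_total m n with hmn | hmn
    · rw [gf_zero ν x (show m < k by omega)]; ring
    · rw [gf_zero ν x (show n < k by omega)]; ring
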